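/- arXiv:math/9903121 — 2 statements merged into one kernel-verified Lean document; each statement's English description precedes it below -/
import Mathlib

section
/- Convolution on probability measures over an undergroup is jointly continuous in the transportation metric: if μ_n*ν_n and μ*ν are defined, ρ_KR(μ_n,μ) → 0 and ρ_KR(ν_n,ν) → 0, then ρ_KR(μ_n*ν_n, μ*ν) → 0. -/
open MeasureTheory Filter Topology
open scoped NNReal ENNReal

/-- Definition 1.1: an undergroup. The partial product is encoded via `Option`. -/
structure Undergroup (G : Type*) [MetricSpace G] where
  mul? : G → G → Option G
  e : G
  unit_left : ∀ f : G, mul? e f = some f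
  unit_right : ∀ f : G, mul? f e = some f
  assoc : ∀ f g h fg gh : G, mul? f g = some fg → mul? g h = some gh →
    ∃ x : G, mul? fg h = some x ∧ mul? f gh = some x
  continuity : ∀ (f g p : G) (fn gn pn : ℕ → G),
    mul? f g = some p → (∀ n, mul? (fn n) (gn n) = some (pn n)) →
    Tendsto fn atTop (nhds f) → Tendsto gn atTop (nhds g) →
    Tendsto pn atTop (nhds p)
  dist_left : ∀ f g fg : G, mul? f g = some fg → dist f fg ≤ dist e g
  dist_right : ∀ f g fg : G, mul? f g = some fg → dist g fg ≤ dist e f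
  dist_le_one : ∀ f g : G, dist f g ≤ 1

variable {G : Type*} [MetricSpace G]

/-- The convolution `μ * ν` is defined iff the product is defined `μ ⊗ ν`-a.e. -/
def ConvDefined {G : Type*} [MetricSpace G] [MeasurableSpace G] (U : Undergroup G)
    (μ ν : Measure G) : Prop :=
  ∀ᵐ p ∂(μ.prod ν), (U.mul? p.1 p.2).isSome

/-- The convolution: pushforward of `μ ⊗ ν` under the (partial) product map. -/
noncomputable def conv {G : Type*} [MetricSpace G] [MeasurableSpace G] (U : Undergroup G)
    (μ ν : Measure G) : Measure G :=
  (μ.prod ν).map (fun p => (U.mul? p.1 p.2).getD U.e)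

/-- Kantorovich–Rubinstein (transportation) metric. -/
noncomputable def rhoKR [MeasurableSpace G] (μ ν : Measure G) : ℝ :=
  ⨆ φ : {φ : G → ℝ // LipschitzWith 1 φ}, |∫ x, φ.1 x ∂μ - ∫ x, φ.1 x ∂ν|


/-- Concentrated on a countable union of compact sets. -/
def SigmaCompactConcentrated {G : Type*} [MetricSpace G] [MeasurableSpace G]
    (μ : Measure G) : Prop :=
  ∃ K : ℕ → Set G, (∀ i, IsCompact (K i)) ∧ μ (⋃ i, K i)ᶜ = 0

/-- The domain of the partial product. -/
def Undergroup.domain (U : Undergroup G) : Set (G × G) := {p | (U.mul? p.1 p.2).isSome}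

/-- The partial product, extended by `e` outside its domain. -/
def Undergroup.mulD (U : Undergroup G) (p : G × G) : G := (U.mul? p.1 p.2).getD U.e

lemma Undergroup.mul?_eq_some (U : Undergroup G) {p : G × G} (hp : p ∈ U.domain) :
    U.mul? p.1 p.2 = some (U.mulD p) := by
  obtain ⟨q, hq⟩ := Option.isSome_iff_exists.1 hp
  simp [Undergroup.mulD, hq]

lemma Undergroup.continuousOn_mulD (U : Undergroup G) : ContinuousOn U.mulD U.domain := by
  intro p hp
  refine tendsto_of_seq_tendsto fun u hu => ?_
  rw [tendsto_nhdsWithin_iff] at hu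
  obtain ⟨N, hN⟩ := eventually_atTop.1 hu.2
  rw [← tendsto_add_atTop_iff_nat N]
  have hu' := (tendsto_add_atTop_iff_nat N).2 hu.1
  exact U.continuity p.1 p.2 _ (fun n => (u (n + N)).1) (fun n => (u (n + N)).2) _
    (U.mul?_eq_some hp) (fun n => U.mul?_eq_some (hN _ (Nat.le_add_left N n)))
    ((continuous_fst.tendsto p).comp hu') ((continuous_snd.tendsto p).comp hu')

lemma rhoKR_nonneg [MeasurableSpace G] (μ ν : Measure G) : 0 ≤ rhoKR μ ν :=
  Real.iSup_nonneg fun _ => abs_nonneg _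

section

variable [MeasurableSpace G] [BorelSpace G]

lemma SigmaCompactConcentrated.exists_isSeparable {μ : Measure G}
    (h : SigmaCompactConcentrated μ) :
    ∃ A : Set G, MeasurableSet A ∧ TopologicalSpace.IsSeparable A ∧ μ Aᶜ = 0 := by
  obtain ⟨K, hK, h0⟩ := h
  exact ⟨⋃ i, K i, MeasurableSet.iUnion fun i => (hK i).measurableSet,
    TopologicalSpace.IsSeparable.iUnion fun i => (hK i).isSeparable, h0⟩

/-- An open set of the product is measurable for the product `σ`-algebra inside a separable
measurable strip. -/
lemma IsOpen.measurableSet_inter_preimage_snd {B : Set G} (hB : MeasurableSet B)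
    (hBs : TopologicalSpace.IsSeparable B) {W : Set (G × G)} (hW : IsOpen W) :
    MeasurableSet (W ∩ Prod.snd ⁻¹' B) := by
  have := hBs.separableSpace
  have : SecondCountableTopology B := UniformSpace.secondCountable_of_separable B
  have hj : MeasurableEmbedding (Prod.map (id : G → G) (Subtype.val : B → G)) :=
    MeasurableEmbedding.id.prodMap (MeasurableEmbedding.subtype_coe hB)
  have ho : IsOpen (Prod.map (id : G → G) (Subtype.val : B → G) ⁻¹' W) :=
    hW.preimage (by fun_prop)
  have := hj.measurableSet_image.2 ho.measurableSet
  rwa [Set.image_preimage_eq_inter_range, Set.range_prodMap, Subtype.range_coe,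
    Set.range_id, Set.univ_prod] at this

lemma ContinuousOn.aemeasurable_prod {E : Type*} [TopologicalSpace E] [MeasurableSpace E]
    [BorelSpace E] [Nonempty E] {μ ν : Measure G} [IsProbabilityMeasure μ] [IsProbabilityMeasure ν]
    (hν : SigmaCompactConcentrated ν) {D : Set (G × G)}
    (hD : ∀ᵐ p ∂(μ.prod ν), p ∈ D) {f : G × G → E} (hf : ContinuousOn f D) :
    AEMeasurable f (μ.prod ν) := by
  classical
  obtain ⟨B, hB, hBs, hB0⟩ := hν.exists_isSeparable
  set M : Set (G × G) := (toMeasurable (μ.prod ν) Dᶜ)ᶜ with hMdef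
  have hM : MeasurableSet M := (measurableSet_toMeasurable _ _).compl
  have hMD : M ⊆ D := Set.compl_subset_comm.1 (subset_toMeasurable _ _)
  have hM0 : ∀ᵐ p ∂(μ.prod ν), p ∈ M := by
    rw [ae_iff]
    have h0 : (μ.prod ν) Dᶜ = 0 := ae_iff.1 hD
    simpa [hMdef, measure_toMeasurable] using h0
  have hBae : ∀ᵐ p ∂(μ.prod ν), p.2 ∈ B :=
    Measure.quasiMeasurePreserving_snd.ae (p := (· ∈ B)) (ae_iff.2 hB0)
  have hS : MeasurableSet (M ∩ Prod.snd ⁻¹' B) := hM.inter (measurable_snd hB)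
  let c : E := Classical.arbitrary E
  refine ⟨Set.piecewise (M ∩ Prod.snd ⁻¹' B) f fun _ => c, measurable_of_isOpen fun O hO => ?_, ?_⟩
  · rw [Set.piecewise_preimage, Set.ite]
    obtain ⟨W, hW, hWD⟩ := continuousOn_iff'.1 hf O hO
    have heq : f ⁻¹' O ∩ (M ∩ Prod.snd ⁻¹' B) = M ∩ (W ∩ Prod.snd ⁻¹' B) := by
      ext p
      have := Set.ext_iff.1 hWD p
      have := @hMD p
      simp only [Set.mem_inter_iff] at *
      tauto
    rw [heq]
    exact (hM.inter (hW.measurableSet_inter_preimage_snd hB hBs)).union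
      ((measurable_const hO.measurableSet).diff hS)
  · filter_upwards [hM0, hBae] with p h1 h2
    exact (Set.piecewise_eq_of_mem (M ∩ Prod.snd ⁻¹' B) _ _ ⟨h1, h2⟩).symm

lemma LipschitzWith.integrable_of_dist_le_one (U : Undergroup G) {μ : Measure G}
    [IsProbabilityMeasure μ] {L : ℝ≥0} {φ : G → ℝ} (hφ : LipschitzWith L φ) : Integrable φ μ := by
  refine Integrable.of_bound hφ.continuous.measurable.aestronglyMeasurable (L + |φ U.e|)
    (ae_of_all _ fun x => ?_)
  have h := hφ.dist_le_mul x U.e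
  have h1 := mul_le_mul_of_nonneg_left (U.dist_le_one x U.e) L.coe_nonneg
  rw [Real.dist_eq] at h
  rw [Real.norm_eq_abs]
  have := abs_sub_abs_le_abs_sub (φ x) (φ U.e)
  linarith

lemma abs_integral_sub_le_rhoKR (U : Undergroup G) (μ ν : Measure G) [IsProbabilityMeasure μ]
    [IsProbabilityMeasure ν] {φ : G → ℝ} (hφ : LipschitzWith 1 φ) :
    |∫ x, φ x ∂μ - ∫ x, φ x ∂ν| ≤ rhoKR μ ν := by
  have key : ∀ (m : Measure G) [IsProbabilityMeasure m] (ψ : G → ℝ), LipschitzWith 1 ψ →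
      |∫ x, ψ x ∂m - ψ U.e| ≤ 1 := by
    intro m _ ψ hψ
    have h1 : ∫ x, ψ x ∂m - ψ U.e = ∫ x, (ψ x - ψ U.e) ∂m := by
      rw [integral_sub (hψ.integrable_of_dist_le_one U) (integrable_const _)]; simp
    rw [h1]
    have := norm_integral_le_of_norm_le_const (μ := m) (f := fun x => ψ x - ψ U.e) (C := 1)
      (ae_of_all _ fun x => by
        have h := hψ.dist_le_mul x U.e
        rw [Real.dist_eq] at h
        simpa using h.trans (by simpa using U.dist_le_one x U.e))
    simpa using this
  have hb : BddAbove (Set.range fun ψ : {ψ : G → ℝ // LipschitzWith 1 ψ} =>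
      |∫ x, ψ.1 x ∂μ - ∫ x, ψ.1 x ∂ν|) := by
    refine ⟨2, ?_⟩
    rintro _ ⟨ψ, rfl⟩
    have h1 := abs_le.1 (key μ ψ.1 ψ.2)
    have h2 := abs_le.1 (key ν ψ.1 ψ.2)
    exact abs_le.2 ⟨by linarith, by linarith⟩
  exact le_ciSup hb ⟨φ, hφ⟩

lemma abs_integral_sub_le_mul_rhoKR (U : Undergroup G) (μ ν : Measure G) [IsProbabilityMeasure μ]
    [IsProbabilityMeasure ν] {L : ℝ≥0} (hL : 0 < L) {φ : G → ℝ} (hφ : LipschitzWith L φ) :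
    |∫ x, φ x ∂μ - ∫ x, φ x ∂ν| ≤ L * rhoKR μ ν := by
  have hL' : (0 : ℝ) < L := hL
  have h : LipschitzWith 1 fun x => (L : ℝ)⁻¹ * φ x := by
    refine LipschitzWith.of_dist_le_mul fun x y => ?_
    have := hφ.dist_le_mul x y
    rw [Real.dist_eq] at this ⊢
    rw [← mul_sub, abs_mul, abs_of_pos (inv_pos.2 hL'), inv_mul_le_iff₀ hL']
    simpa using this
  have := abs_integral_sub_le_rhoKR U μ ν h
  rw [integral_const_mul, integral_const_mul, ← mul_sub, abs_mul, abs_of_pos (inv_pos.2 hL'),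
    inv_mul_le_iff₀ hL'] at this
  exact this

/-- A bounded function on the product that is Lipschitz has product integrals that vary
Lipschitz-continuously in the transportation metric. -/
lemma abs_integral_prod_sub_le (U : Undergroup G) {μ ν μ' ν' : Measure G}
    [IsProbabilityMeasure μ] [IsProbabilityMeasure ν] [IsProbabilityMeasure μ']
    [IsProbabilityMeasure ν'] (hν : SigmaCompactConcentrated ν)
    (hν' : SigmaCompactConcentrated ν')
    {L : ℝ≥0} (hL : 0 < L) {H : G × G → ℝ} (hH : LipschitzWith L H) {c : ℝ}
    (hb : ∀ p, |H p| ≤ c) :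
    |∫ p, H p ∂(μ'.prod ν') - ∫ p, H p ∂(μ.prod ν)| ≤ L * (rhoKR μ' μ + rhoKR ν' ν) := by
  have hint : ∀ (a b : Measure G) [IsProbabilityMeasure a] [IsProbabilityMeasure b],
      SigmaCompactConcentrated b → Integrable H (a.prod b) := by
    intro a b _ _ hb'
    exact Integrable.of_bound (hH.continuous.continuousOn.aemeasurable_prod hb'
      (D := Set.univ) (by simp)).aestronglyMeasurable c (ae_of_all _ hb)
  have h1 : |∫ p, H p ∂(μ'.prod ν') - ∫ p, H p ∂(μ'.prod ν)| ≤ L * rhoKR ν' ν := by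
    have i1 := hint μ' ν' hν'
    have i2 := hint μ' ν hν
    rw [integral_prod _ i1, integral_prod _ i2,
      ← integral_sub i1.integral_prod_left i2.integral_prod_left]
    have := norm_integral_le_of_norm_le_const (μ := μ')
      (f := fun x => ∫ y, H (x, y) ∂ν' - ∫ y, H (x, y) ∂ν) (ae_of_all _ fun x =>
        abs_integral_sub_le_mul_rhoKR U ν' ν hL (φ := fun y => H (x, y))
          (by simpa [Function.comp_def] using hH.comp (LipschitzWith.prodMk_left x)))
    simpa using this
  have h2 : |∫ p, H p ∂(μ'.prod ν) - ∫ p, H p ∂(μ.prod ν)| ≤ L * rhoKR μ' μ := by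
    have i1 := hint μ' ν hν
    have i2 := hint μ ν hν
    rw [integral_prod_symm _ i1, integral_prod_symm _ i2,
      ← integral_sub i1.integral_prod_right i2.integral_prod_right]
    have := norm_integral_le_of_norm_le_const (μ := ν)
      (f := fun y => ∫ x, H (x, y) ∂μ' - ∫ x, H (x, y) ∂μ) (ae_of_all _ fun y =>
        abs_integral_sub_le_mul_rhoKR U μ' μ hL (φ := fun x => H (x, y))
          (by simpa [Function.comp_def] using hH.comp (LipschitzWith.prodMk_right y)))
    simpa using this
  have h3 := abs_sub_le (∫ p, H p ∂(μ'.prod ν')) (∫ p, H p ∂(μ'.prod ν)) (∫ p, H p ∂(μ.prod ν))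
  linarith

end

/-- A function bounded by `1` that has a uniform modulus of continuity at the points of `C` has a
bounded Lipschitz almost-majorant, which is a minorant on `C`. -/
lemma exists_lipschitz_almost_majorant {X : Type*} [PseudoMetricSpace X] {C D : Set X}
    (hC : C.Nonempty) {F : X → ℝ} (hF : ∀ x, |F x| ≤ 1) {L : ℝ≥0} {ε : ℝ}
    (h : ∀ z ∈ C, ∀ w ∈ D, L * dist w z < 2 → |F w - F z| ≤ ε) (hε : 0 ≤ ε) :
    ∃ H : X → ℝ, LipschitzWith L H ∧ (∀ x, |H x| ≤ 1) ∧ (∀ w ∈ D, F w ≤ H w + ε) ∧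
      ∀ z ∈ C, H z ≤ F z := by
  have := hC.to_subtype
  have hF1 : ∀ x, -1 ≤ F x := fun x => (abs_le.1 (hF x)).1
  have hF2 : ∀ x, F x ≤ 1 := fun x => (abs_le.1 (hF x)).2
  have hlow : ∀ (w : X) (z : C), -1 ≤ F z + L * dist w z := fun w z => by
    have : 0 ≤ L * dist w z := by positivity
    linarith [hF1 z]
  have hbdd : ∀ w : X, BddBelow (Set.range fun z : C => F z + L * dist w z) := fun w =>
    ⟨-1, by rintro _ ⟨z, rfl⟩; exact hlow w z⟩
  have hlip : LipschitzWith L fun w : X => ⨅ z : C, (F z + L * dist w z) := by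
    refine LipschitzWith.of_le_add_mul L fun x y => ?_
    rw [← sub_le_iff_le_add]
    refine le_ciInf fun z => ?_
    have h1 := ciInf_le (hbdd x) z
    have h2 := mul_le_mul_of_nonneg_left (dist_triangle x y z) L.coe_nonneg
    linarith
  refine ⟨fun w => min 1 (⨅ z : C, (F z + L * dist w z)), hlip.const_min 1, fun w => ?_,
    fun w hw => ?_, fun z hz => ?_⟩
  · exact abs_le.2 ⟨le_min (by norm_num) (le_ciInf (hlow w)), min_le_left _ _⟩
  · rw [← sub_le_iff_le_add]
    refine le_min (by linarith [hF2 w]) (le_ciInf fun z => ?_)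
    rcases lt_or_ge (L * dist w z) 2 with hlt | hge
    · have := (abs_le.1 (h z z.2 w hw hlt)).2
      have : 0 ≤ L * dist w z := by positivity
      linarith
    · linarith [hF1 z, hF2 w]
  · refine (min_le_right _ _).trans ((ciInf_le (hbdd z) ⟨z, hz⟩).trans ?_)
    simp

/-- A function that is continuous on a conull set has a uniform modulus of continuity at the points
of a set of nearly full outer measure. -/
lemma ContinuousOn.exists_uniform_modulus {X Y : Type*} [PseudoMetricSpace X] [PseudoMetricSpace Y]
    [MeasurableSpace X] (P : Measure X) [IsProbabilityMeasure P] {D : Set X}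
    (hD : ∀ᵐ x ∂P, x ∈ D) {f : X → Y} (hf : ContinuousOn f D) {ε : ℝ} (hε : 0 < ε) :
    ∃ (C : Set X) (L : ℝ≥0), 0 < L ∧ 1 - ENNReal.ofReal ε < P C ∧
      ∀ z ∈ C, ∀ w ∈ D, L * dist w z < 2 → dist (f w) (f z) ≤ ε := by
  set C : ℕ → Set X := fun k =>
    {z | ∀ w ∈ D, ((k + 1 : ℝ≥0) : ℝ) * dist w z < 2 → dist (f w) (f z) ≤ ε} with hCdef
  have hmono : Monotone C := by
    intro k l hkl z hz w hw hlt
    refine hz w hw (lt_of_le_of_lt (mul_le_mul_of_nonneg_right ?_ dist_nonneg) hlt)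
    push_cast
    have : (k : ℝ) ≤ l := by exact_mod_cast hkl
    linarith
  have hunion : D ⊆ ⋃ k, C k := by
    intro z hz
    obtain ⟨δ, hδ, h⟩ := Metric.continuousOn_iff.1 hf z hz ε hε
    obtain ⟨k, hk⟩ := exists_nat_gt (2 / δ)
    refine Set.mem_iUnion.2 ⟨k, fun w hw hlt => (h w hw ?_).le⟩
    push_cast at hlt
    by_contra! hge
    rw [div_lt_iff₀ hδ] at hk
    have : (k : ℝ) * δ ≤ k * dist w z := by gcongr
    nlinarith [dist_nonneg (x := w) (y := z)]
  have h1 : P (⋃ k, C k) = 1 := by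
    have : ∀ᵐ x ∂P, x ∈ ⋃ k, C k := hD.mono fun x hx => hunion hx
    exact (measure_congr (eventuallyEq_univ.2 this)).trans measure_univ
  have ht := tendsto_measure_iUnion_atTop (μ := P) hmono
  rw [h1] at ht
  have hlt : 1 - ENNReal.ofReal ε < 1 :=
    ENNReal.sub_lt_self ENNReal.one_ne_top one_ne_zero (by simpa using hε)
  obtain ⟨k, hk⟩ := (ht.eventually_const_lt hlt).exists
  exact ⟨C k, k + 1, by positivity, hk, fun z hz => hz⟩

section

variable [MeasurableSpace G] [BorelSpace G]

lemma ConvDefined.aemeasurable_mulD {U : Undergroup G} {μ ν : Measure G} [IsProbabilityMeasure μ]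
    [IsProbabilityMeasure ν] (h : ConvDefined U μ ν)
    (hν : SigmaCompactConcentrated ν) : AEMeasurable U.mulD (μ.prod ν) :=
  have : Nonempty G := ⟨U.e⟩
  U.continuousOn_mulD.aemeasurable_prod hν h

lemma ConvDefined.integral_conv {U : Undergroup G} {μ ν : Measure G} [IsProbabilityMeasure μ]
    [IsProbabilityMeasure ν] (h : ConvDefined U μ ν)
    (hν : SigmaCompactConcentrated ν) {φ : G → ℝ} (hφ : Continuous φ) :
    ∫ x, φ x ∂(conv U μ ν) = ∫ p, φ (U.mulD p) ∂(μ.prod ν) :=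
  integral_map (h.aemeasurable_mulD hν) hφ.measurable.aestronglyMeasurable

lemma ConvDefined.isProbabilityMeasure_conv {U : Undergroup G} {μ ν : Measure G}
    [IsProbabilityMeasure μ] [IsProbabilityMeasure ν] (h : ConvDefined U μ ν)
    (hν : SigmaCompactConcentrated ν) :
    IsProbabilityMeasure (conv U μ ν) :=
  Measure.isProbabilityMeasure_map (h.aemeasurable_mulD hν)

/-- If `H ≤ F` off a set of measure at most `ε`, and both are bounded by `1`, the integral of `H`
exceeds that of `F` by at most `2 * ε`. -/
lemma integral_le_integral_add_of_outer_measure {X : Type*} [MeasurableSpace X] {P : Measure X}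
    [IsProbabilityMeasure P] {F H : X → ℝ} (hFm : AEMeasurable F P) (hHm : AEMeasurable H P)
    (hF : ∀ x, |F x| ≤ 1) (hH : ∀ x, |H x| ≤ 1) {C : Set X} (hC : ∀ z ∈ C, H z ≤ F z) {ε : ℝ}
    (hε : 0 ≤ ε) (hPC : 1 - ENNReal.ofReal ε < P C) :
    ∫ x, H x ∂P ≤ ∫ x, F x ∂P + 2 * ε := by
  have hm : NullMeasurableSet {x | H x ≤ F x} P := nullMeasurableSet_le hHm hFm
  have hle : P {x | H x ≤ F x}ᶜ ≤ ENNReal.ofReal ε := by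
    rw [prob_compl_eq_one_sub₀ hm, tsub_le_iff_left, ← tsub_le_iff_right]
    exact hPC.le.trans (measure_mono hC)
  have hreal : P.real {x | H x ≤ F x}ᶜ ≤ ε := ENNReal.toReal_le_of_le_ofReal hε hle
  have iF : Integrable F P := Integrable.of_bound hFm.aestronglyMeasurable 1 (ae_of_all _ hF)
  have iH : Integrable H P := Integrable.of_bound hHm.aestronglyMeasurable 1 (ae_of_all _ hH)
  have iI : Integrable ({x | H x ≤ F x}ᶜ.indicator fun _ => (2 : ℝ)) P :=
    (integrable_const 2).indicator₀ hm.compl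
  have hint : ∫ x, H x ∂P ≤ ∫ x, (F x + {x | H x ≤ F x}ᶜ.indicator (fun _ => (2 : ℝ)) x) ∂P := by
    refine integral_mono iH (iF.add iI) fun x => ?_
    by_cases hx : H x ≤ F x
    · simp [hx]
    · have := (abs_le.1 (hF x)).1
      have := (abs_le.1 (hH x)).2
      simp only [Set.mem_compl_iff, Set.mem_ofPred_eq, hx, not_false_eq_true,
        Set.indicator_of_mem]
      linarith
  rw [integral_add iF iI, integral_indicator₀ hm.compl, setIntegral_const, smul_eq_mul] at hint
  linarith

/-- The modulus of continuity of convolution at `(μ, ν)`. -/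
lemma exists_rhoKR_conv_le (U : Undergroup G) {μ ν : Measure G} [IsProbabilityMeasure μ]
    [IsProbabilityMeasure ν] (hν : SigmaCompactConcentrated ν)
    (hdef : ConvDefined U μ ν) {ε : ℝ} (hε : 0 < ε) :
    ∃ L : ℝ, 0 < L ∧ ∀ (μ' ν' : Measure G) [IsProbabilityMeasure μ'] [IsProbabilityMeasure ν'],
      SigmaCompactConcentrated ν' → ConvDefined U μ' ν' →
      rhoKR (conv U μ' ν') (conv U μ ν) ≤ 3 * ε + L * (rhoKR μ' μ + rhoKR ν' ν) := by
  obtain ⟨C, L, hL, hPC, hC⟩ := U.continuousOn_mulD.exists_uniform_modulus (μ.prod ν) hdef hε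
  have hCne : C.Nonempty := by
    rw [Set.nonempty_iff_ne_empty]
    rintro rfl
    simp at hPC
  refine ⟨L, hL, fun μ' ν' _ _ hν' hdef' => ?_⟩
  have := hdef.isProbabilityMeasure_conv hν
  have := hdef'.isProbabilityMeasure_conv hν'
  have centered : ∀ φ : G → ℝ, LipschitzWith 1 φ → φ U.e = 0 →
      ∫ x, φ x ∂(conv U μ' ν') - ∫ x, φ x ∂(conv U μ ν) ≤
        3 * ε + L * (rhoKR μ' μ + rhoKR ν' ν) := by
    intro φ hφ h0
    have hF : ∀ p, |φ (U.mulD p)| ≤ 1 := fun p => by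
      have h := hφ.dist_le_mul (U.mulD p) U.e
      rw [Real.dist_eq, h0, sub_zero, NNReal.coe_one, one_mul] at h
      exact h.trans (U.dist_le_one _ _)
    obtain ⟨H, hHL, hHb, hHD, hHC⟩ := exists_lipschitz_almost_majorant (D := U.domain) hCne hF
      (fun z hz w hw hlt => by
        have h := hφ.dist_le_mul (U.mulD w) (U.mulD z)
        rw [Real.dist_eq, NNReal.coe_one, one_mul] at h
        exact h.trans (hC z hz w hw hlt)) hε.le
    have hφm := hφ.continuous.measurable
    have hHm := hHL.continuous.continuousOn.aemeasurable_prod (μ := μ) hν (D := Set.univ) (by simp)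
    have hHm' := hHL.continuous.continuousOn.aemeasurable_prod (μ := μ') hν' (D := Set.univ)
      (by simp)
    rw [hdef.integral_conv hν hφ.continuous, hdef'.integral_conv hν' hφ.continuous]
    have h1 := integral_le_integral_add_of_outer_measure
      (hφm.comp_aemeasurable (hdef.aemeasurable_mulD hν)) hHm hF hHb hHC hε.le hPC
    have h2 := (abs_le.1 (abs_integral_prod_sub_le U (μ := μ) (μ' := μ') hν hν' hL hHL hHb)).2
    have iF : Integrable (fun p => φ (U.mulD p)) (μ'.prod ν') :=
      Integrable.of_bound (hφm.comp_aemeasurable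
        (hdef'.aemeasurable_mulD hν')).aestronglyMeasurable 1 (ae_of_all _ hF)
    have iH : Integrable H (μ'.prod ν') :=
      Integrable.of_bound hHm'.aestronglyMeasurable 1 (ae_of_all _ hHb)
    have h3 : ∫ p, φ (U.mulD p) ∂(μ'.prod ν') ≤ ∫ p, (H p + ε) ∂(μ'.prod ν') :=
      integral_mono_ae iF (iH.add (integrable_const _)) (hdef'.mono fun p hp => hHD p hp)
    rw [integral_add iH (integrable_const _)] at h3
    simp only [integral_const, probReal_univ, one_smul] at h3
    simp only [Function.comp_def] at h1
    linarith
  have oneSided : ∀ φ : G → ℝ, LipschitzWith 1 φ →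
      ∫ x, φ x ∂(conv U μ' ν') - ∫ x, φ x ∂(conv U μ ν) ≤
        3 * ε + L * (rhoKR μ' μ + rhoKR ν' ν) := by
    intro φ hφ
    have h := centered (fun x => φ x - φ U.e)
      (LipschitzWith.of_dist_le_mul fun x y => by simpa using hφ.dist_le_mul x y) (sub_self _)
    rw [integral_sub (hφ.integrable_of_dist_le_one U) (integrable_const _),
      integral_sub (hφ.integrable_of_dist_le_one U) (integrable_const _)] at h
    simpa using h
  have : Nonempty {φ : G → ℝ // LipschitzWith 1 φ} := ⟨⟨fun _ => 0, LipschitzWith.const' 0⟩⟩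
  refine ciSup_le fun φ => abs_sub_le_iff.2 ⟨oneSided φ.1 φ.2, ?_⟩
  have h := oneSided (fun x => -φ.1 x) φ.2.neg
  simp only [integral_neg] at h
  linarith

end

/-- joint continuity of convolution in the transportation metric. -/
theorem conv_continuous {G : Type*} [MetricSpace G] [MeasurableSpace G] [BorelSpace G]
    (U : Undergroup G)
    (μ ν : Measure G) (μs νs : ℕ → Measure G)
    [IsProbabilityMeasure μ] [IsProbabilityMeasure ν]
    (hμs : ∀ n, IsProbabilityMeasure (μs n)) (hνs : ∀ n, IsProbabilityMeasure (νs n))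
    (hc : SigmaCompactConcentrated μ ∧ SigmaCompactConcentrated ν ∧
      ∀ n, SigmaCompactConcentrated (μs n) ∧ SigmaCompactConcentrated (νs n))
    (hdef : ConvDefined U μ ν) (hdefn : ∀ n, ConvDefined U (μs n) (νs n))
    (hμ : Tendsto (fun n => rhoKR (μs n) μ) atTop (nhds 0))
    (hν : Tendsto (fun n => rhoKR (νs n) ν) atTop (nhds 0)) :
    Tendsto (fun n => rhoKR (conv U (μs n) (νs n)) (conv U μ ν)) atTop (nhds 0) := by
  obtain ⟨-, hcν, hcn⟩ := hc
  rw [Metric.tendsto_atTop]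
  intro η hη
  have hε : 0 < η / 6 := by positivity
  obtain ⟨L, hL, h⟩ := exists_rhoKR_conv_le U hcν hdef hε
  have hlim : Tendsto (fun n => L * (rhoKR (μs n) μ + rhoKR (νs n) ν)) atTop (nhds 0) := by
    simpa using (hμ.add hν).const_mul L
  obtain ⟨N, hN⟩ := eventually_atTop.1 (hlim.eventually_lt_const (half_pos hη))
  refine ⟨N, fun n hn => ?_⟩
  have := hμs n
  have := hνs n
  rw [Real.dist_eq, sub_zero, abs_of_nonneg (rhoKR_nonneg _ _)]
  have h1 := h (μs n) (νs n) (hcn n).2 (hdefn n)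
  have h2 := hN n hn
  linarith
end

section
/- The set M(G) of probability measures on an undergroup G (concentrated on countable unions of compact sets), equipped with the transportation metric ρ_KR and convolution, is itself an undergroup, with unity δ_e. -/
open MeasureTheory Filter Topology
open scoped NNReal ENNReal

variable {G : Type*} [MetricSpace G]

/-- The space `M(G)` of probability measures concentrated on countable unions
of compact sets. -/
def MG (G : Type*) [MetricSpace G] [MeasurableSpace G] :=
  {μ : Measure G // IsProbabilityMeasure μ ∧ SigmaCompactConcentrated μ}

/-- A finite measure that is the image of a measure on a σ-compact metric Borel space under a
continuous measurable embedding. Unlike the σ-algebra of `T`, which may fail to contain the open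
sets (as for products of nonseparable spaces), the one of the source is always Borel. -/
def CompactlyCarried.{u} {T : Type u} [TopologicalSpace T] [MeasurableSpace T] (P : Measure T) :
    Prop :=
  ∃ (X : Type u) (_ : MetricSpace X) (_ : SigmaCompactSpace X) (_ : MeasurableSpace X)
    (_ : BorelSpace X) (Q : Measure X) (f : X → T),
    IsFiniteMeasure Q ∧ Continuous f ∧ MeasurableEmbedding f ∧ P = Q.map f

theorem SigmaCompactConcentrated.compactlyCarried {G : Type*} [MetricSpace G] [MeasurableSpace G]
    [BorelSpace G] {μ : Measure G} [IsFiniteMeasure μ] (h : SigmaCompactConcentrated μ) :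
    CompactlyCarried μ := by
  obtain ⟨K, hK, hμ⟩ := h
  have hm : MeasurableSet (⋃ i, K i) := .iUnion fun i => (hK i).isClosed.measurableSet
  have hσ : SigmaCompactSpace (⋃ i, K i) :=
    isSigmaCompact_iff_sigmaCompactSpace.1 (isSigmaCompact_iUnion_of_isCompact K hK)
  have he := MeasurableEmbedding.subtype_coe hm
  refine ⟨_, inferInstance, hσ, inferInstance, inferInstance, μ.comap Subtype.val, Subtype.val,
    ⟨?_⟩, continuous_subtype_val, he, ?_⟩
  · rw [he.comap_apply]
    exact measure_lt_top _ _
  · rw [map_comap_subtype_coe hm, Measure.restrict_eq_self_of_ae_mem]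
    exact measure_eq_zero_iff_ae_notMem.1 hμ |>.mono fun x hx => by simpa using hx

namespace CompactlyCarried

theorem prod {T S : Type*} [TopologicalSpace T] [MeasurableSpace T] [TopologicalSpace S]
    [MeasurableSpace S] {P : Measure T} {R : Measure S} (hP : CompactlyCarried P)
    (hR : CompactlyCarried R) : CompactlyCarried (P.prod R) := by
  obtain ⟨X, _, _, _, _, Q, f, _, hf, hfe, rfl⟩ := hP
  obtain ⟨Y, _, _, _, _, Q', g, _, hg, hge, rfl⟩ := hR
  exact ⟨X × Y, inferInstance, inferInstance, inferInstance, inferInstance, Q.prod Q',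
    Prod.map f g, inferInstance, hf.prodMap hg, hfe.prodMap hge,
    Measure.map_prod_map _ _ hfe.measurable hge.measurable⟩

variable {T : Type*} [TopologicalSpace T] [MeasurableSpace T] {P : Measure T}

theorem exists_isCompact_measure_compl_lt (hP : CompactlyCarried P) {D : Set T}
    (hD : ∀ᵐ t ∂P, t ∈ D) {ε : ℝ≥0∞} (hε : ε ≠ 0) :
    ∃ C ⊆ D, IsCompact C ∧ MeasurableSet C ∧ P Cᶜ < ε := by
  obtain ⟨X, _, _, _, _, Q, f, _, hf, hfe, rfl⟩ := hP
  rw [hfe.ae_map_iff] at hD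
  obtain ⟨A, hA, hAm, hQA⟩ := exists_measurable_superset_of_null (ae_iff.1 hD)
  obtain ⟨C, hCA, hC, hQC⟩ :=
    hAm.compl.exists_isCompact_sdiff_lt (measure_ne_top Q _) hε
  refine ⟨f '' C, ?_, hC.image hf, hfe.measurableSet_image.2 hC.isClosed.measurableSet, ?_⟩
  · rintro _ ⟨x, hx, rfl⟩
    by_contra h
    exact hCA hx (hA h)
  · rw [hfe.map_apply, Set.preimage_compl, hfe.injective.preimage_image]
    calc Q Cᶜ ≤ Q (Aᶜ \ C ∪ A) := measure_mono fun x hx => by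
          by_cases h : x ∈ A
          · exact .inr h
          · exact .inl ⟨h, hx⟩
      _ ≤ Q (Aᶜ \ C) + Q A := measure_union_le _ _
      _ < ε := by simpa [hQA] using hQC

theorem exists_isCompact_iUnion (hP : CompactlyCarried P) {D : Set T} (hD : ∀ᵐ t ∂P, t ∈ D) :
    ∃ C : ℕ → Set T, (∀ n, C n ⊆ D) ∧ (∀ n, IsCompact (C n)) ∧ P (⋃ n, C n)ᶜ = 0 := by
  have hε (n : ℕ) : ((n : ℝ≥0∞) + 1)⁻¹ ≠ 0 := by simp
  choose C hCD hC _ hPC using fun n => hP.exists_isCompact_measure_compl_lt hD (hε n)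
  refine ⟨C, hCD, hC, ?_⟩
  have hlim : Tendsto (fun n : ℕ => ((n : ℝ≥0∞) + 1)⁻¹) atTop (𝓝 0) := by
    simpa using (tendsto_add_atTop_iff_nat 1).2 ENNReal.tendsto_inv_nat_nhds_zero
  refine nonpos_iff_eq_zero.1 (ge_of_tendsto' hlim fun n => (measure_mono ?_).trans (hPC n).le)
  exact Set.compl_subset_compl.2 (Set.subset_iUnion C n)

theorem aemeasurable_of_continuousOn (hP : CompactlyCarried P) {E : Type*} [TopologicalSpace E]
    [MeasurableSpace E] [BorelSpace E] {h : T → E} {D : Set T} (hh : ContinuousOn h D)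
    (hD : ∀ᵐ t ∂P, t ∈ D) : AEMeasurable h P := by
  obtain ⟨X, _, _, _, _, Q, f, _, hf, hfe, rfl⟩ := hP
  rw [hfe.ae_map_iff] at hD
  rw [hfe.aemeasurable_map_iff]
  have hc : ContinuousOn (h ∘ f) (f ⁻¹' D) := hh.comp hf.continuousOn fun _ hx => hx
  rw [← Measure.restrict_eq_self_of_ae_mem hD]
  exact hc.aemeasurable₀ (NullMeasurableSet.of_compl (.of_null (ae_iff.1 hD)))

theorem integrable_of_continuousOn [IsFiniteMeasure P] (hP : CompactlyCarried P) {h : T → ℝ}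
    {D : Set T} (hh : ContinuousOn h D) (hD : ∀ᵐ t ∂P, t ∈ D) (c : ℝ) (hc : ∀ t, |h t| ≤ c) :
    Integrable h P :=
  .of_bound (hP.aemeasurable_of_continuousOn hh hD).aestronglyMeasurable c (.of_forall hc)

end CompactlyCarried

theorem IsCompact.measurableSet_prod {G H : Type*} [MetricSpace G] [MeasurableSpace G]
    [BorelSpace G] [MetricSpace H] [MeasurableSpace H] [BorelSpace H] {C : Set (G × H)}
    (hC : IsCompact C) : MeasurableSet C := by
  have hK := hC.image continuous_fst
  have hL := hC.image continuous_snd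
  have := isCompact_iff_compactSpace.1 hK
  have := isCompact_iff_compactSpace.1 hL
  have he := (MeasurableEmbedding.subtype_coe hK.isClosed.measurableSet).prodMap
    (MeasurableEmbedding.subtype_coe hL.isClosed.measurableSet)
  have hcont : Continuous (Prod.map Subtype.val Subtype.val :
      (Prod.fst '' C) × (Prod.snd '' C) → G × H) := by fun_prop
  have hCeq : Prod.map Subtype.val Subtype.val ''
      ((Prod.map Subtype.val Subtype.val :
        (Prod.fst '' C) × (Prod.snd '' C) → G × H) ⁻¹' C) = C := by
    refine Set.image_preimage_eq_of_subset fun p hp => ?_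
    exact ⟨(⟨p.1, p, hp, rfl⟩, ⟨p.2, p, hp, rfl⟩), rfl⟩
  rw [← hCeq]
  exact he.measurableSet_image.2 (hC.isClosed.preimage hcont).measurableSet

/-- An almost everywhere property of an image measure may be checked on points, without any
measurability assumption, if the map is continuous on a set of full measure. -/
theorem CompactlyCarried.ae_map_of_mapsTo {T G H : Type*} [TopologicalSpace T] [MeasurableSpace T]
    [MetricSpace G] [MeasurableSpace G] [BorelSpace G] [MetricSpace H] [MeasurableSpace H]
    [BorelSpace H] {P : Measure T} (hP : CompactlyCarried P) {q : T → G × H} {D : Set T}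
    {E : Set (G × H)} (hD : ∀ᵐ t ∂P, t ∈ D) (hq : ContinuousOn q D) (hqm : AEMeasurable q P)
    (hDE : Set.MapsTo q D E) : ∀ᵐ y ∂(P.map q), y ∈ E := by
  obtain ⟨C, hCD, hC, hnull⟩ := hP.exists_isCompact_iUnion hD
  have hK (n : ℕ) : IsCompact (q '' C n) := (hC n).image_of_continuousOn (hq.mono (hCD n))
  have hmem : ∀ᵐ y ∂(P.map q), y ∈ ⋃ n, q '' C n := by
    refine (ae_map_iff hqm (MeasurableSet.iUnion fun n => (hK n).measurableSet_prod)).2 ?_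
    filter_upwards [measure_eq_zero_iff_ae_notMem.1 hnull] with t ht
    obtain ⟨n, hn⟩ := Set.mem_iUnion.1 (not_not.1 ht)
    exact Set.mem_iUnion.2 ⟨n, t, hn, rfl⟩
  filter_upwards [hmem] with y hy
  obtain ⟨n, t, ht, rfl⟩ := Set.mem_iUnion.1 hy
  exact hDE (hCD n ht)

section AEMeasurable

variable {α β γ δ : Type*} [MeasurableSpace α] [MeasurableSpace β] [MeasurableSpace γ]
  [MeasurableSpace δ] {μ : Measure α} {ν : Measure γ} {f : α → β} {g : γ → δ}

theorem AEMeasurable.prod_map (hf : AEMeasurable f μ) (hg : AEMeasurable g ν) :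
    AEMeasurable (Prod.map f g) (μ.prod ν) :=
  (hf.comp_quasiMeasurePreserving Measure.quasiMeasurePreserving_fst).prodMk
    (hg.comp_quasiMeasurePreserving Measure.quasiMeasurePreserving_snd)

theorem MeasureTheory.Measure.map_prod_map_of_aemeasurable [SFinite μ] [SFinite ν]
    (hf : AEMeasurable f μ) (hg : AEMeasurable g ν) :
    (μ.map f).prod (ν.map g) = (μ.prod ν).map (Prod.map f g) := by
  rw [Measure.map_congr hf.ae_eq_mk, Measure.map_congr hg.ae_eq_mk,
    Measure.map_prod_map _ _ hf.measurable_mk hg.measurable_mk]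
  refine Measure.map_congr ?_
  filter_upwards [Measure.quasiMeasurePreserving_fst.ae hf.ae_eq_mk,
    Measure.quasiMeasurePreserving_snd.ae hg.ae_eq_mk] with p h1 h2
  simp [Prod.map, h1, h2]

end AEMeasurable

section KantorovichRubinstein

variable {G : Type*} [MetricSpace G] [MeasurableSpace G]

theorem rhoKR_le {μ ν : Measure G} {c : ℝ}
    (h : ∀ φ : G → ℝ, LipschitzWith 1 φ → ∫ x, φ x ∂μ - ∫ x, φ x ∂ν ≤ c) :
    rhoKR μ ν ≤ c := by
  have : Nonempty {φ : G → ℝ // LipschitzWith 1 φ} :=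
    ⟨fun _ => 0, (LipschitzWith.const 0).weaken zero_le_one⟩
  refine ciSup_le fun φ => abs_le'.2 ⟨h _ φ.2, ?_⟩
  have := h (-φ.1) φ.2.neg
  simp only [Pi.neg_apply, integral_neg] at this
  linarith

theorem rhoKR_comm (μ ν : Measure G) : rhoKR μ ν = rhoKR ν μ := by
  simp only [rhoKR, abs_sub_comm]

variable [BorelSpace G]

theorem LipschitzWith.integrable_of_dist_le {φ : G → ℝ} {L : ℝ≥0} (hφ : LipschitzWith L φ)
    {c : ℝ} (hd : ∀ x y : G, dist x y ≤ c) (μ : Measure G) [IsFiniteMeasure μ] :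
    Integrable φ μ := by
  rcases isEmpty_or_nonempty G with _ | ⟨⟨x₀⟩⟩
  · exact (integrable_zero G ℝ μ).congr (.of_forall fun x => isEmptyElim x)
  refine .of_bound hφ.continuous.measurable.aestronglyMeasurable (|φ x₀| + L * c)
    (.of_forall fun x => ?_)
  have h1 := hφ.dist_le_mul x x₀
  have h2 : (L : ℝ) * dist x x₀ ≤ L * c := by gcongr; exact hd _ _
  rw [Real.dist_eq] at h1
  have h3 := abs_add_le (φ x - φ x₀) (φ x₀)
  rw [sub_add_cancel] at h3
  rw [Real.norm_eq_abs]
  linarith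

theorem abs_integral_sub_integral_le_one (hd : ∀ x y : G, dist x y ≤ 1)
    {φ : G → ℝ} (hφ : LipschitzWith 1 φ) (μ ν : Measure G)
    [IsProbabilityMeasure μ] [IsProbabilityMeasure ν] :
    |∫ x, φ x ∂μ - ∫ x, φ x ∂ν| ≤ 1 := by
  have hμ := hφ.integrable_of_dist_le hd μ
  have hν := hφ.integrable_of_dist_le hd ν
  have hφ' (x y : G) : |φ x - φ y| ≤ 1 := by
    simpa [Real.dist_eq] using (hφ.dist_le_mul x y).trans (by simpa using hd x y)
  have key (y : G) : |∫ x, φ x ∂μ - φ y| ≤ 1 := by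
    have : ∫ x, φ x ∂μ - φ y = ∫ x, (φ x - φ y) ∂μ := by
      rw [integral_sub hμ (integrable_const _)]; simp
    rw [this]
    simpa using norm_integral_le_of_norm_le_const (μ := μ)
      (.of_forall fun x => hφ' x y : ∀ᵐ x ∂μ, ‖φ x - φ y‖ ≤ 1)
  have : ∫ x, φ x ∂μ - ∫ x, φ x ∂ν = ∫ y, (∫ x, φ x ∂μ - φ y) ∂ν := by
    rw [integral_sub (integrable_const _) hν]; simp
  rw [this]
  simpa using norm_integral_le_of_norm_le_const (μ := ν)
    (.of_forall key : ∀ᵐ y ∂ν, ‖∫ x, φ x ∂μ - φ y‖ ≤ 1)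

theorem abs_integral_sub_integral_le_rhoKR (hd : ∀ x y : G, dist x y ≤ 1)
    {φ : G → ℝ} (hφ : LipschitzWith 1 φ)
    (μ ν : Measure G) [IsProbabilityMeasure μ] [IsProbabilityMeasure ν] :
    |∫ x, φ x ∂μ - ∫ x, φ x ∂ν| ≤ rhoKR μ ν :=
  le_ciSup (f := fun φ : {φ : G → ℝ // LipschitzWith 1 φ} => |∫ x, φ.1 x ∂μ - ∫ x, φ.1 x ∂ν|)
    ⟨1, by rintro _ ⟨φ, rfl⟩; exact abs_integral_sub_integral_le_one hd φ.2 μ ν⟩ ⟨φ, hφ⟩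

theorem abs_integral_sub_integral_le_mul_rhoKR (hd : ∀ x y : G, dist x y ≤ 1)
    {φ : G → ℝ} {L : ℝ≥0} (hφ : LipschitzWith L φ)
    (μ ν : Measure G) [IsProbabilityMeasure μ] [IsProbabilityMeasure ν] :
    |∫ x, φ x ∂μ - ∫ x, φ x ∂ν| ≤ L * rhoKR μ ν := by
  rcases eq_or_ne L 0 with rfl | hL
  · obtain ⟨x₀⟩ := nonempty_of_isProbabilityMeasure μ
    have : φ = fun _ => φ x₀ := funext fun x => by
      simpa [sub_eq_zero] using hφ.dist_le_mul x x₀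
    rw [this]
    simp
  · have hL' : (0 : ℝ) < L := by positivity
    have h1 : LipschitzWith 1 (fun x => (L : ℝ)⁻¹ * φ x) := by
      refine LipschitzWith.of_dist_le_mul fun x y => ?_
      have := hφ.dist_le_mul x y
      rw [Real.dist_eq] at this ⊢
      rw [← mul_sub, abs_mul, abs_inv, abs_of_pos hL', inv_mul_le_iff₀ hL']
      simpa using this
    have h2 := abs_integral_sub_integral_le_rhoKR hd h1 μ ν
    rwa [integral_const_mul, integral_const_mul, ← mul_sub, abs_mul, abs_inv, abs_of_pos hL',
      inv_mul_le_iff₀ hL'] at h2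

theorem eq_of_rhoKR_eq_zero (hd : ∀ x y : G, dist x y ≤ 1)
    {μ ν : Measure G} [IsProbabilityMeasure μ] [IsProbabilityMeasure ν]
    (h : rhoKR μ ν = 0) : μ = ν := by
  let μ' : ProbabilityMeasure G := ⟨μ, ‹_›⟩
  let ν' : ProbabilityMeasure G := ⟨ν, ‹_›⟩
  have ht : Tendsto (fun _ : ℕ => μ') atTop (𝓝 ν') := by
    rw [tendsto_iff_forall_lipschitz_integral_tendsto]
    rintro φ - ⟨L, hφ⟩
    have := abs_integral_sub_integral_le_mul_rhoKR hd hφ μ ν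
    rw [h, mul_zero] at this
    exact tendsto_const_nhds_iff.2 (sub_eq_zero.1 (abs_nonpos_iff.1 this))
  have heq : μ' = ν' := tendsto_const_nhds_iff.1 ht
  exact congrArg Subtype.val heq

/-- The transportation metric on `M(G)` for a metric space `G` of diameter at most one. -/
noncomputable abbrev transportMetricSpace (hd : ∀ x y : G, dist x y ≤ 1) :
    MetricSpace (MG G) where
  dist μ ν := rhoKR μ.1 ν.1
  dist_self μ := by simp [rhoKR]
  dist_comm μ ν := rhoKR_comm _ _
  dist_triangle μ ν σ := by
    have := μ.2.1
    have := ν.2.1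
    have := σ.2.1
    refine rhoKR_le fun φ hφ => ?_
    have h1 := le_of_abs_le (abs_integral_sub_integral_le_rhoKR hd hφ μ.1 ν.1)
    have h2 := le_of_abs_le (abs_integral_sub_integral_le_rhoKR hd hφ ν.1 σ.1)
    linarith
  eq_of_dist_eq_zero {μ ν} h := by
    have := μ.2.1
    have := ν.2.1
    exact Subtype.ext (eq_of_rhoKR_eq_zero hd h)

/-- A function on `G × G` that is Lipschitz in each variable has nearby integrals against nearby
product measures. -/
theorem integral_prod_sub_integral_prod_le (hd : ∀ x y : G, dist x y ≤ 1)
    {ψ : G × G → ℝ} {L : ℝ≥0} (hψ : LipschitzWith L ψ)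
    {c : ℝ} (hc : ∀ p, |ψ p| ≤ c) (μ ν μ' ν' : MG G) :
    ∫ p, ψ p ∂(μ'.1.prod ν'.1) - ∫ p, ψ p ∂(μ.1.prod ν.1) ≤
      L * (rhoKR μ'.1 μ.1 + rhoKR ν'.1 ν.1) := by
  have := μ.2.1
  have := ν.2.1
  have := μ'.2.1
  have := ν'.2.1
  have hψi (α β : MG G) : Integrable ψ (α.1.prod β.1) := by
    have := α.2.1
    have := β.2.1
    exact (α.2.2.compactlyCarried.prod β.2.2.compactlyCarried).integrable_of_continuousOn
      hψ.continuous.continuousOn (D := Set.univ) (by simp) c hc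
  have h1 : ∫ p, ψ p ∂(μ'.1.prod ν'.1) - ∫ p, ψ p ∂(μ.1.prod ν'.1) ≤ L * rhoKR μ'.1 μ.1 := by
    rw [integral_prod_symm _ (hψi μ' ν'), integral_prod_symm _ (hψi μ ν'),
      ← integral_sub (hψi μ' ν').integral_prod_right (hψi μ ν').integral_prod_right]
    refine (integral_mono ((hψi μ' ν').integral_prod_right.sub
      (hψi μ ν').integral_prod_right) (integrable_const (L * rhoKR μ'.1 μ.1)) fun y => ?_).trans
      (by simp)
    have hy : LipschitzWith L fun x => ψ (x, y) := by
      simpa [Function.comp_def] using hψ.comp (LipschitzWith.prodMk_right y)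
    exact le_of_abs_le (abs_integral_sub_integral_le_mul_rhoKR hd hy _ _)
  have h2 : ∫ p, ψ p ∂(μ.1.prod ν'.1) - ∫ p, ψ p ∂(μ.1.prod ν.1) ≤ L * rhoKR ν'.1 ν.1 := by
    rw [integral_prod _ (hψi μ ν'), integral_prod _ (hψi μ ν),
      ← integral_sub (hψi μ ν').integral_prod_left (hψi μ ν).integral_prod_left]
    refine (integral_mono ((hψi μ ν').integral_prod_left.sub
      (hψi μ ν).integral_prod_left) (integrable_const (L * rhoKR ν'.1 ν.1)) fun x => ?_).trans
      (by simp)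
    have hx : LipschitzWith L fun y => ψ (x, y) := by
      simpa [Function.comp_def] using hψ.comp (LipschitzWith.prodMk_left x)
    exact le_of_abs_le (abs_integral_sub_integral_le_mul_rhoKR hd hx _ _)
  linarith

end KantorovichRubinstein

namespace Undergroup

section Product

variable {G : Type*} [MetricSpace G] (U : Undergroup G)

/-- The product of a pair, with junk value `e` where it is not defined. -/
def op (p : G × G) : G := (U.mul? p.1 p.2).getD U.e

/-- The set of pairs whose product is defined. -/
def dom : Set (G × G) := {p | (U.mul? p.1 p.2).isSome}

theorem mul?_eq_some_op {p : G × G} (hp : p ∈ U.dom) : U.mul? p.1 p.2 = some (U.op p) := by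
  obtain ⟨x, hx⟩ := Option.isSome_iff_exists.1 hp
  simp [op, hx]

theorem mem_dom {f g x : G} (h : U.mul? f g = some x) : (f, g) ∈ U.dom := by
  simp [dom, h]

theorem op_eq {f g x : G} (h : U.mul? f g = some x) : U.op (f, g) = x := by
  simp [op, h]

theorem continuousOn_op : ContinuousOn U.op U.dom := by
  rw [continuousOn_iff_continuous_domRestrict, continuous_iff_seqContinuous]
  intro u p hu
  have hu' := (continuous_subtype_val.tendsto p).comp hu
  exact U.continuity p.1.1 p.1.2 _ _ _ _ (U.mul?_eq_some_op p.2)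
    (fun n => U.mul?_eq_some_op (u n).2) ((continuous_fst.tendsto _).comp hu')
    ((continuous_snd.tendsto _).comp hu')

theorem op_assoc {f g h : G} (hfg : (f, g) ∈ U.dom) (hgh : (g, h) ∈ U.dom) :
    (U.op (f, g), h) ∈ U.dom ∧ (f, U.op (g, h)) ∈ U.dom ∧
      U.op (U.op (f, g), h) = U.op (f, U.op (g, h)) := by
  obtain ⟨x, h1, h2⟩ := U.assoc _ _ _ _ _ (U.mul?_eq_some_op hfg) (U.mul?_eq_some_op hgh)
  exact ⟨U.mem_dom h1, U.mem_dom h2, (U.op_eq h1).trans (U.op_eq h2).symm⟩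

theorem exists_dist_op_lt {C : Set (G × G)} (hC : IsCompact C) (hCD : C ⊆ U.dom) {ε : ℝ}
    (hε : 0 < ε) :
    ∃ δ > 0, ∀ c ∈ C, ∀ d ∈ U.dom, dist c d < δ → dist (U.op c) (U.op d) < ε := by
  have hC' : IsCompact ((↑) ⁻¹' C : Set U.dom) :=
    Topology.IsInducing.subtypeVal.isCompact_preimage' hC (by simpa using hCD)
  have h := hC'.uniformContinuousAt_of_continuousAt (U.dom.domRestrict U.op)
    (fun a _ => (continuousOn_iff_continuous_domRestrict.1 U.continuousOn_op).continuousAt)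
    (Metric.dist_mem_uniformity hε)
  obtain ⟨δ, hδ, hsub⟩ := Metric.mem_uniformity_dist.1 h
  exact ⟨δ, hδ, fun c hc d hd hcd => hsub (a := ⟨c, hCD hc⟩) (b := ⟨d, hd⟩) hcd hc⟩

/-- On the domain of the product, `φ ∘ op` is dominated by a Lipschitz function that nearly agrees
with it on a given compact set. -/
theorem exists_lipschitz_majorant {C : Set (G × G)} (hC : IsCompact C) (hCD : C ⊆ U.dom)
    (hne : C.Nonempty) {ε : ℝ} (hε : 0 < ε) :
    ∃ L : ℝ≥0, ∀ φ : G → ℝ, LipschitzWith 1 φ → ∃ ψ : G × G → ℝ, LipschitzWith L ψ ∧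
      (∀ p, |ψ p| ≤ |φ U.e| + 2) ∧ (∀ p ∈ U.dom, φ (U.op p) ≤ ψ p + ε) ∧
      (∀ p ∈ C, ψ p ≤ φ (U.op p)) ∧ ∀ p, ψ p ≤ φ (U.op p) + 2 := by
  obtain ⟨δ, hδ, hδC⟩ := U.exists_dist_op_lt hC hCD hε
  have := hne.to_subtype
  refine ⟨⟨δ⁻¹, by positivity⟩, fun φ hφ => ?_⟩
  have hφd (x y : G) : φ x - φ y ≤ dist x y := by
    simpa [Real.dist_eq] using (le_abs_self _).trans (hφ.dist_le_mul x y)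
  have hφ1 (x y : G) : φ x - φ y ≤ 1 := (hφd x y).trans (U.dist_le_one x y)
  let b (p : G × G) (c : C) : ℝ := φ (U.op c) + min 1 (δ⁻¹ * dist c.1 p)
  have hmin (p : G × G) (c : C) : 0 ≤ min 1 (δ⁻¹ * dist c.1 p) := by positivity
  have hlow (p : G × G) (c : C) : φ U.e - 1 ≤ b p c := by
    have := hmin p c
    have := hφ1 U.e (U.op c)
    simp only [b]
    linarith
  have hup (p : G × G) (c : C) (x : G) : b p c ≤ φ x + 2 := by
    have := min_le_left 1 (δ⁻¹ * dist c.1 p)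
    have := hφ1 (U.op c) x
    simp only [b]
    linarith
  have hbdd (p : G × G) : BddBelow (Set.range (b p)) :=
    ⟨φ U.e - 1, by rintro _ ⟨c, rfl⟩; exact hlow p c⟩
  obtain ⟨c₀⟩ := ‹Nonempty C›
  have hψ2 (p : G × G) (x : G) : ⨅ c, b p c ≤ φ x + 2 := (ciInf_le (hbdd p) c₀).trans (hup p c₀ x)
  refine ⟨fun p => ⨅ c, b p c, ?_, fun p => ?_, fun p hp => ?_, fun p hp => ?_, fun p => hψ2 p _⟩
  · refine LipschitzWith.of_le_add_mul _ fun p q => ?_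
    rw [← sub_le_iff_le_add]
    refine le_ciInf fun c => sub_le_iff_le_add.2 ((ciInf_le (hbdd p) c).trans ?_)
    have h1 : dist c.1 p ≤ dist c.1 q + dist p q := by
      rw [dist_comm p q]
      exact dist_triangle _ _ _
    have h2 : δ⁻¹ * dist c.1 p ≤ δ⁻¹ * dist c.1 q + δ⁻¹ * dist p q := by
      rw [← mul_add]
      gcongr
    have h3 : 0 ≤ δ⁻¹ * dist p q := by positivity
    change b p c ≤ b q c + δ⁻¹ * dist p q
    simp only [b]
    rcases min_cases 1 (δ⁻¹ * dist c.1 p) with ⟨h, h'⟩ | ⟨h, h'⟩ <;>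
    rcases min_cases 1 (δ⁻¹ * dist c.1 q) with ⟨k, k'⟩ | ⟨k, k'⟩ <;> linarith
  · have h1 : φ U.e - 1 ≤ ⨅ c, b p c := le_ciInf (hlow p)
    have h2 := hψ2 p U.e
    rw [abs_le]
    constructor <;> linarith [neg_abs_le (φ U.e), le_abs_self (φ U.e)]
  · rw [← sub_le_iff_le_add]
    refine le_ciInf fun c => ?_
    simp only [b]
    rcases lt_or_ge (dist c.1 p) δ with h | h
    · have h1 := hδC c.1 c.2 p hp h
      have h2 := hφd (U.op p) (U.op c)
      rw [dist_comm] at h2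
      linarith [hmin p c]
    · have h1 : 1 ≤ δ⁻¹ * dist c.1 p := by
        rw [le_inv_mul_iff₀ hδ, mul_one]
        exact h
      rw [min_eq_left h1]
      linarith [hφ1 (U.op p) (U.op c)]
  · simpa [b] using ciInf_le (hbdd p) ⟨p, hp⟩

end Product

section Convolution

theorem ae_mem_dom_and_mem_dom {G : Type*} [MetricSpace G] [MeasurableSpace G]
    {U : Undergroup G} {μ ν σ : MG G} (h₁ : ConvDefined U μ.1 ν.1)
    (h₂ : ConvDefined U ν.1 σ.1) :
    ∀ᵐ t ∂((μ.1.prod ν.1).prod σ.1), t.1 ∈ U.dom ∧ (t.1.2, t.2) ∈ U.dom := by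
  have := μ.2.1
  have := ν.2.1
  have := σ.2.1
  have h : ∀ᵐ t ∂(μ.1.prod (ν.1.prod σ.1)), t.2 ∈ U.dom :=
    Measure.quasiMeasurePreserving_snd.ae h₂
  rw [← Measure.prodAssoc_prod] at h
  filter_upwards [Measure.quasiMeasurePreserving_fst.ae h₁,
    ae_of_ae_map MeasurableEquiv.prodAssoc.measurable.aemeasurable h] with t ht₁ ht₂
  exact ⟨ht₁, ht₂⟩

variable {G : Type*} [MetricSpace G] [MeasurableSpace G] [BorelSpace G]

theorem compactlyCarried_prod (μ ν : MG G) : CompactlyCarried (μ.1.prod ν.1) :=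
  have := μ.2.1
  have := ν.2.1
  μ.2.2.compactlyCarried.prod ν.2.2.compactlyCarried

variable {U : Undergroup G} {μ ν σ : MG G}

theorem aemeasurable_op (h : ConvDefined U μ.1 ν.1) : AEMeasurable U.op (μ.1.prod ν.1) :=
  (compactlyCarried_prod μ ν).aemeasurable_of_continuousOn U.continuousOn_op h

/-- The convolution as an element of `M(G)`. -/
noncomputable def convMG (h : ConvDefined U μ.1 ν.1) : MG G :=
  ⟨conv U μ.1 ν.1, by
    have := μ.2.1
    have := ν.2.1
    refine ⟨Measure.isProbabilityMeasure_map (aemeasurable_op h), ?_⟩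
    obtain ⟨C, hCD, hC, hnull⟩ := (compactlyCarried_prod μ ν).exists_isCompact_iUnion h
    have hK (n : ℕ) : IsCompact (U.op '' C n) := (hC n).image_of_continuousOn
      (U.continuousOn_op.mono (hCD n))
    refine ⟨fun n => U.op '' C n, hK, ?_⟩
    rw [show conv U μ.1 ν.1 = (μ.1.prod ν.1).map U.op from rfl,
      Measure.map_apply_of_aemeasurable (aemeasurable_op h)
      (MeasurableSet.iUnion fun n => (hK n).isClosed.measurableSet).compl]
    refine measure_mono_null (Set.subset_compl_comm.1 fun p hpC hp => hp ?_) hnull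
    obtain ⟨n, hn⟩ := Set.mem_iUnion.1 hpC
    exact Set.mem_iUnion.2 ⟨n, p, hn, rfl⟩⟩

theorem integral_conv (h : ConvDefined U μ.1 ν.1) {φ : G → ℝ} (hφ : Continuous φ) :
    ∫ x, φ x ∂(conv U μ.1 ν.1) = ∫ p, φ (U.op p) ∂(μ.1.prod ν.1) :=
  integral_map (aemeasurable_op h) hφ.measurable.aestronglyMeasurable

theorem integrable_comp_op (h : ConvDefined U μ.1 ν.1) {φ : G → ℝ} (hφ : LipschitzWith 1 φ) :
    Integrable (fun p => φ (U.op p)) (μ.1.prod ν.1) := by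
  have := (convMG h).2.1
  exact (hφ.integrable_of_dist_le U.dist_le_one (convMG h).1).comp_aemeasurable (aemeasurable_op h)

theorem rhoKR_conv_left_le (h : ConvDefined U μ.1 ν.1) :
    rhoKR μ.1 (conv U μ.1 ν.1) ≤ rhoKR (Measure.dirac U.e) ν.1 := by
  have := μ.2.1
  have := ν.2.1
  refine rhoKR_le fun φ hφ => ?_
  have hdist : LipschitzWith 1 fun x => dist U.e x := LipschitzWith.dist_right U.e
  have hφi := (hφ.integrable_of_dist_le U.dist_le_one μ.1).comp_fst ν.1
  have hle : ∫ p, (φ p.1 - φ (U.op p)) ∂(μ.1.prod ν.1) ≤ ∫ p, dist U.e p.2 ∂(μ.1.prod ν.1) := by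
    refine integral_mono_ae (hφi.sub (integrable_comp_op h hφ))
      ((hdist.integrable_of_dist_le U.dist_le_one ν.1).comp_snd μ.1) ?_
    filter_upwards [h] with p hp
    have h1 := U.dist_left _ _ _ (U.mul?_eq_some_op hp)
    have h2 := (le_abs_self _).trans (hφ.dist_le_mul p.1 (U.op p))
    simp only [NNReal.coe_one, one_mul] at h2
    exact h2.trans h1
  rw [integral_sub hφi (integrable_comp_op h hφ), integral_fun_fst, integral_fun_snd] at hle
  have hKR := abs_integral_sub_integral_le_rhoKR U.dist_le_one hdist (Measure.dirac U.e) ν.1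
  rw [integral_dirac, dist_self, zero_sub, abs_neg] at hKR
  rw [integral_conv h hφ.continuous]
  simp only [probReal_univ, one_smul] at hle
  exact hle.trans ((le_abs_self _).trans hKR)

theorem rhoKR_conv_right_le (h : ConvDefined U μ.1 ν.1) :
    rhoKR ν.1 (conv U μ.1 ν.1) ≤ rhoKR (Measure.dirac U.e) μ.1 := by
  have := μ.2.1
  have := ν.2.1
  refine rhoKR_le fun φ hφ => ?_
  have hdist : LipschitzWith 1 fun x => dist U.e x := LipschitzWith.dist_right U.e
  have hφi := (hφ.integrable_of_dist_le U.dist_le_one ν.1).comp_snd μ.1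
  have hle : ∫ p, (φ p.2 - φ (U.op p)) ∂(μ.1.prod ν.1) ≤ ∫ p, dist U.e p.1 ∂(μ.1.prod ν.1) := by
    refine integral_mono_ae (hφi.sub (integrable_comp_op h hφ))
      ((hdist.integrable_of_dist_le U.dist_le_one μ.1).comp_fst ν.1) ?_
    filter_upwards [h] with p hp
    have h1 := U.dist_right _ _ _ (U.mul?_eq_some_op hp)
    have h2 := (le_abs_self _).trans (hφ.dist_le_mul p.2 (U.op p))
    simp only [NNReal.coe_one, one_mul] at h2
    exact h2.trans h1
  rw [integral_sub hφi (integrable_comp_op h hφ), integral_fun_fst, integral_fun_snd] at hle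
  have hKR := abs_integral_sub_integral_le_rhoKR U.dist_le_one hdist (Measure.dirac U.e) μ.1
  rw [integral_dirac, dist_self, zero_sub, abs_neg] at hKR
  rw [integral_conv h hφ.continuous]
  simp only [probReal_univ, one_smul] at hle
  exact hle.trans ((le_abs_self _).trans hKR)

theorem convDefined_dirac_left (ν : MG G) : ConvDefined U (Measure.dirac U.e) ν.1 := by
  have := ν.2.1
  have h : ∀ᵐ p ∂((Measure.dirac U.e).prod ν.1), p.1 = U.e := by
    rw [Measure.dirac_prod, ae_map_iff measurable_prodMk_left.aemeasurable
      (p := fun p => p.1 = U.e) (measurable_fst (measurableSet_singleton U.e))]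
    simp
  filter_upwards [h] with p hp
  simp [hp, U.unit_left]

theorem convDefined_dirac_right (μ : MG G) : ConvDefined U μ.1 (Measure.dirac U.e) := by
  have := μ.2.1
  have h : ∀ᵐ p ∂(μ.1.prod (Measure.dirac U.e)), p.2 = U.e := by
    rw [Measure.prod_dirac, ae_map_iff measurable_prodMk_right.aemeasurable
      (p := fun p => p.2 = U.e) (measurable_snd (measurableSet_singleton U.e))]
    simp
  filter_upwards [h] with p hp
  simp [hp, U.unit_right]

variable (U) in
/-- The unit mass at `e` as an element of `M(G)`. -/
noncomputable def diracMG : MG G :=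
  ⟨Measure.dirac U.e, inferInstance, fun _ => {U.e}, fun _ => isCompact_singleton, by
    simp⟩

theorem conv_dirac_left (ν : MG G) : conv U (Measure.dirac U.e) ν.1 = ν.1 := by
  have := ν.2.1
  have hop := aemeasurable_op (μ := diracMG U) (convDefined_dirac_left ν)
  simp only [diracMG, Measure.dirac_prod] at hop
  rw [show conv U (Measure.dirac U.e) ν.1 = ((Measure.dirac U.e).prod ν.1).map U.op from rfl,
    Measure.dirac_prod, hop.map_map_of_aemeasurable measurable_prodMk_left.aemeasurable]
  convert Measure.map_id
  exact funext fun g => U.op_eq (U.unit_left g)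

theorem conv_dirac_right (μ : MG G) : conv U μ.1 (Measure.dirac U.e) = μ.1 := by
  have := μ.2.1
  have hop := aemeasurable_op (ν := diracMG U) (convDefined_dirac_right μ)
  simp only [diracMG, Measure.prod_dirac] at hop
  rw [show conv U μ.1 (Measure.dirac U.e) = (μ.1.prod (Measure.dirac U.e)).map U.op from rfl,
    Measure.prod_dirac, hop.map_map_of_aemeasurable measurable_prodMk_right.aemeasurable]
  convert Measure.map_id
  exact funext fun g => U.op_eq (U.unit_right g)

/-- Convolution is continuous for the transportation metric, with a modulus of continuity. -/
theorem exists_rhoKR_conv_le (h : ConvDefined U μ.1 ν.1) {ε : ℝ} (hε : 0 < ε) :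
    ∃ L : ℝ≥0, ∀ μ' ν' : MG G, ConvDefined U μ'.1 ν'.1 →
      rhoKR (conv U μ'.1 ν'.1) (conv U μ.1 ν.1) ≤
        ε + L * (rhoKR μ'.1 μ.1 + rhoKR ν'.1 ν.1) := by
  have := μ.2.1
  have := ν.2.1
  obtain ⟨C, hCD, hC, hCm, hPC⟩ := (compactlyCarried_prod μ ν).exists_isCompact_measure_compl_lt h
    (ε := ENNReal.ofReal (min 1 (ε / 4))) (by simp; positivity)
  have hPC' : (μ.1.prod ν.1).real Cᶜ < min 1 (ε / 4) :=
    ENNReal.toReal_lt_of_lt_ofReal hPC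
  have hne : C.Nonempty := by
    by_contra hempty
    rw [Set.not_nonempty_iff_eq_empty.1 hempty] at hPC'
    simp at hPC'
  obtain ⟨L, hL⟩ := U.exists_lipschitz_majorant hC hCD hne (half_pos hε)
  refine ⟨L, fun μ' ν' h' => rhoKR_le fun φ hφ => ?_⟩
  have := μ'.2.1
  have := ν'.2.1
  obtain ⟨ψ, hψ, hψb, hdom, hψC, hψ2⟩ := hL φ hφ
  have hψi (α β : MG G) : Integrable ψ (α.1.prod β.1) := by
    have := α.2.1
    have := β.2.1
    exact (compactlyCarried_prod α β).integrable_of_continuousOn hψ.continuous.continuousOn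
      (D := Set.univ) (by simp) _ hψb
  have h1 : ∫ p, φ (U.op p) ∂(μ'.1.prod ν'.1) ≤ ∫ p, ψ p ∂(μ'.1.prod ν'.1) + ε / 2 := by
    calc _ ≤ ∫ p, (ψ p + ε / 2) ∂(μ'.1.prod ν'.1) :=
          integral_mono_ae (integrable_comp_op h' hφ) ((hψi μ' ν').add (integrable_const _))
            (h'.mono fun p hp => hdom p hp)
      _ = _ := by
          rw [integral_add (hψi μ' ν') (integrable_const _)]
          simp
  have h2 := integral_prod_sub_integral_prod_le U.dist_le_one hψ hψb μ ν μ' ν'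
  have hind : Integrable (Cᶜ.indicator fun _ => (2 : ℝ)) (μ.1.prod ν.1) :=
    (integrable_const 2).indicator hCm.compl
  have h3 : ∫ p, ψ p ∂(μ.1.prod ν.1) ≤ ∫ p, φ (U.op p) ∂(μ.1.prod ν.1) + ε / 2 := by
    calc _ ≤ ∫ p, (φ (U.op p) + Cᶜ.indicator (fun _ => (2 : ℝ)) p) ∂(μ.1.prod ν.1) := by
          refine integral_mono (hψi μ ν) ((integrable_comp_op h hφ).add hind) fun p => ?_
          by_cases hp : p ∈ C
          · simpa [hp] using hψC p hp
          · simpa [hp] using hψ2 p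
      _ = ∫ p, φ (U.op p) ∂(μ.1.prod ν.1) + (μ.1.prod ν.1).real Cᶜ * 2 := by
          rw [integral_add (integrable_comp_op h hφ) hind, integral_indicator_const _ hCm.compl,
            smul_eq_mul]
      _ ≤ _ := by
          have := hPC'.le.trans (min_le_right _ _)
          linarith
  rw [integral_conv h' hφ.continuous, integral_conv h hφ.continuous]
  linarith

theorem conv_prod_eq_map (h : ConvDefined U μ.1 ν.1) (σ : MG G) :
    (conv U μ.1 ν.1).prod σ.1 = ((μ.1.prod ν.1).prod σ.1).map (Prod.map U.op id) := by
  have := μ.2.1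
  have := ν.2.1
  have := σ.2.1
  rw [← Measure.map_prod_map_of_aemeasurable (aemeasurable_op h) aemeasurable_id, Measure.map_id]
  rfl

theorem prod_conv_eq_map (h : ConvDefined U ν.1 σ.1) (μ : MG G) :
    μ.1.prod (conv U ν.1 σ.1) = (μ.1.prod (ν.1.prod σ.1)).map (Prod.map id U.op) := by
  have := μ.2.1
  have := ν.2.1
  have := σ.2.1
  rw [← Measure.map_prod_map_of_aemeasurable aemeasurable_id (aemeasurable_op h), Measure.map_id]
  rfl

theorem convDefined_conv_left (h₁ : ConvDefined U μ.1 ν.1) (h₂ : ConvDefined U ν.1 σ.1) :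
    ConvDefined U (conv U μ.1 ν.1) σ.1 := by
  have := μ.2.1
  have := ν.2.1
  have := σ.2.1
  unfold ConvDefined
  rw [conv_prod_eq_map h₁ σ]
  refine ((compactlyCarried_prod μ ν).prod σ.2.2.compactlyCarried).ae_map_of_mapsTo
    (ae_mem_dom_and_mem_dom h₁ h₂) ?_ ((aemeasurable_op h₁).prod_map aemeasurable_id)
    fun t ht => (U.op_assoc ht.1 ht.2).1
  exact (U.continuousOn_op.comp continuous_fst.continuousOn fun t ht => ht.1).prodMk
    continuous_snd.continuousOn

theorem convDefined_conv_right (h₁ : ConvDefined U μ.1 ν.1) (h₂ : ConvDefined U ν.1 σ.1) :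
    ConvDefined U μ.1 (conv U ν.1 σ.1) := by
  have := μ.2.1
  have := ν.2.1
  have := σ.2.1
  unfold ConvDefined
  rw [prod_conv_eq_map h₂ μ]
  have hD : ∀ᵐ t ∂(μ.1.prod (ν.1.prod σ.1)), (t.1, t.2.1) ∈ U.dom ∧ t.2 ∈ U.dom := by
    rw [← Measure.prodAssoc_prod, MeasurableEquiv.prodAssoc.measurableEmbedding.ae_map_iff]
    exact ae_mem_dom_and_mem_dom h₁ h₂
  refine (μ.2.2.compactlyCarried.prod (compactlyCarried_prod ν σ)).ae_map_of_mapsTo hD ?_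
    (aemeasurable_id.prod_map (aemeasurable_op h₂)) fun t ht => (U.op_assoc ht.1 ht.2).2.1
  exact continuous_fst.continuousOn.prodMk
    (U.continuousOn_op.comp continuous_snd.continuousOn fun t ht => ht.2)

theorem conv_assoc (h₁ : ConvDefined U μ.1 ν.1) (h₂ : ConvDefined U ν.1 σ.1) :
    conv U (conv U μ.1 ν.1) σ.1 = conv U μ.1 (conv U ν.1 σ.1) := by
  have := μ.2.1
  have := ν.2.1
  have := σ.2.1
  have hl := aemeasurable_op (μ := convMG h₁) (convDefined_conv_left h₁ h₂)
  have hr := aemeasurable_op (ν := convMG h₂) (convDefined_conv_right h₁ h₂)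
  change AEMeasurable _ ((conv U μ.1 ν.1).prod σ.1) at hl
  change AEMeasurable _ (μ.1.prod (conv U ν.1 σ.1)) at hr
  change ((conv U μ.1 ν.1).prod σ.1).map U.op = (μ.1.prod (conv U ν.1 σ.1)).map U.op
  rw [conv_prod_eq_map h₁ σ] at hl ⊢
  rw [prod_conv_eq_map h₂ μ] at hr ⊢
  have hm := aemeasurable_id.prod_map (μ := μ.1) (aemeasurable_op h₂)
  rw [hl.map_map_of_aemeasurable ((aemeasurable_op h₁).prod_map aemeasurable_id),
    hr.map_map_of_aemeasurable hm]
  have hc := hr.comp_aemeasurable hm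
  rw [← Measure.prodAssoc_prod] at hc ⊢
  rw [hc.map_map_of_aemeasurable MeasurableEquiv.prodAssoc.measurable.aemeasurable]
  refine Measure.map_congr ?_
  filter_upwards [ae_mem_dom_and_mem_dom h₁ h₂] with t ht
  exact (U.op_assoc ht.1 ht.2).2.2

open Classical in
variable (U) in
/-- The partial convolution on `M(G)`. -/
noncomputable def conv? (μ ν : MG G) : Option (MG G) :=
  if h : ConvDefined U μ.1 ν.1 then some (convMG h) else none

theorem conv?_eq_some_iff :
    U.conv? μ ν = some σ ↔ ConvDefined U μ.1 ν.1 ∧ conv U μ.1 ν.1 = σ.1 := by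
  unfold conv?
  split_ifs with h
  · rw [Option.some_inj]
    exact ⟨fun hσ => ⟨h, congrArg Subtype.val hσ⟩, fun hσ => Subtype.ext hσ.2⟩
  · simp [h]

theorem isSome_conv?_iff : (U.conv? μ ν).isSome ↔ ConvDefined U μ.1 ν.1 := by
  unfold conv?
  split_ifs with h <;> simp [h]

variable (U) in
/-- The undergroup of measures on an undergroup. -/
noncomputable def measures : @Undergroup (MG G) (transportMetricSpace U.dist_le_one) :=
  letI := transportMetricSpace (G := G) U.dist_le_one
  { mul? := U.conv?
    e := diracMG U
    unit_left := fun ν => conv?_eq_some_iff.2 ⟨convDefined_dirac_left ν, conv_dirac_left ν⟩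
    unit_right := fun μ => conv?_eq_some_iff.2 ⟨convDefined_dirac_right μ, conv_dirac_right μ⟩
    assoc := by
      intro μ ν σ μν νσ h h'
      obtain ⟨h₁, e₁⟩ := conv?_eq_some_iff.1 h
      obtain ⟨h₂, e₂⟩ := conv?_eq_some_iff.1 h'
      have hl := convDefined_conv_left h₁ h₂
      have hr := convDefined_conv_right h₁ h₂
      have ha := conv_assoc h₁ h₂
      rw [e₁] at hl ha
      rw [e₂] at hr ha
      exact ⟨convMG hl, conv?_eq_some_iff.2 ⟨hl, rfl⟩, conv?_eq_some_iff.2 ⟨hr, ha.symm⟩⟩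
    continuity := by
      intro μ ν π μs νs πs h hs hμ hν
      obtain ⟨h, e⟩ := conv?_eq_some_iff.1 h
      rw [tendsto_iff_dist_tendsto_zero] at hμ hν ⊢
      rw [Metric.tendsto_atTop]
      intro ε hε
      obtain ⟨L, hL⟩ := exists_rhoKR_conv_le h (half_pos hε)
      have hlim := ((hμ.add hν).const_mul (L : ℝ)).const_add (ε / 2)
      simp only [add_zero, mul_zero] at hlim
      obtain ⟨N, hN⟩ := eventually_atTop.1 (hlim.eventually_lt_const (half_lt_self hε))
      refine ⟨N, fun n hn => ?_⟩
      obtain ⟨hn', en⟩ := conv?_eq_some_iff.1 (hs n)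
      have hle := hL _ _ hn'
      rw [e, en] at hle
      rw [dist_zero_right, Real.norm_of_nonneg dist_nonneg]
      exact hle.trans_lt (hN n hn)
    dist_left := by
      intro μ ν σ h
      obtain ⟨h, e⟩ := conv?_eq_some_iff.1 h
      have hle := rhoKR_conv_left_le h
      rwa [e] at hle
    dist_right := by
      intro μ ν σ h
      obtain ⟨h, e⟩ := conv?_eq_some_iff.1 h
      have hle := rhoKR_conv_right_le h
      rwa [e] at hle
    dist_le_one := by
      intro μ ν
      have := μ.2.1
      have := ν.2.1
      exact rhoKR_le fun φ hφ =>
        le_of_abs_le (abs_integral_sub_integral_le_one U.dist_le_one hφ μ.1 ν.1) }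

end Convolution

end Undergroup

/-- `M(G)`, with the transportation metric and convolution,
is itself an undergroup, with unity `δ_e`. -/
theorem MG_undergroup {G : Type*} [MetricSpace G] [MeasurableSpace G] [BorelSpace G]
    (U : Undergroup G) :
    ∃ m : MetricSpace (MG G),
      (∀ μ ν : MG G, @dist _ m.toDist μ ν = rhoKR μ.1 ν.1) ∧
      ∃ V : @Undergroup (MG G) m,
        V.e.1 = Measure.dirac U.e ∧
        ∀ μ ν : MG G,
          ((V.mul? μ ν).isSome ↔ ConvDefined U μ.1 ν.1) ∧
          ∀ σ : MG G, V.mul? μ ν = some σ → σ.1 = conv U μ.1 ν.1 := by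
  refine ⟨transportMetricSpace U.dist_le_one, fun _ _ => rfl, U.measures, rfl, fun μ ν =>
    ⟨Undergroup.isSome_conv?_iff, fun σ h => ?_⟩⟩
  exact (Undergroup.conv?_eq_some_iff.1 h).2.symm
end
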